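/- arXiv:1808.00243 — 8 statements merged into one kernel-verified Lean document; each statement's English description precedes it below -/
import Mathlib

section
/- Let G be a group, H ≤ G a subgroup of index 2, and x ∈ G ∖ H. Let (r, V) be a finite-dimensional irreducible representation of H over ℂ, and let r^x denote the representation of H on V defined by r^x(h) = r(x h x⁻¹). Then r admits an extension to a representation of G on V (i.e., there exists a representation r₀ of G on V with r₀(h) = r(h) for all h ∈ H) if and only if r is isomorphic to r^x. -/
/-- A subgroup of index 2 is normal. -/
theorem normal_of_index_two {G : Type*} [Group G] {H : Subgroup G} (hH : H.index = 2) :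
    H.Normal := by
  constructor
  intro n hn g
  rw [Subgroup.mul_mem_iff_of_index_two hH, Subgroup.mul_mem_iff_of_index_two hH,
    H.inv_mem_iff]
  simp [hn]

/-- An isomorphism (equivalence) of representations. -/
def RepIso {k G V W : Type*} [CommRing k] [Monoid G] [AddCommGroup V] [Module k V]
    [AddCommGroup W] [Module k W] (ρ : Representation k G V) (τ : Representation k G W) :
    Prop :=
  ∃ e : V ≃ₗ[k] W, ∀ (g : G) (v : V), e (ρ g v) = τ g (e v)

/-- A representation is irreducible if the space is nonzero and the only invariant
submodules are `⊥` and `⊤`. -/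
def IsIrreducibleRep {k G V : Type*} [CommRing k] [Monoid G] [AddCommGroup V] [Module k V]
    (ρ : Representation k G V) : Prop :=
  (⊥ : Submodule k V) ≠ ⊤ ∧
    ∀ p : Submodule k V, (∀ (g : G), ∀ v ∈ p, ρ g v ∈ p) → p = ⊥ ∨ p = ⊤

/-- Conjugation by `x ∈ G` as an automorphism of a normal subgroup `H`. -/
def conjHom {G : Type*} [Group G] {H : Subgroup G} (hN : H.Normal) (x : G) : H →* H where
  toFun h := ⟨x * h * x⁻¹, hN.conj_mem h.1 h.2 x⟩
  map_one' := by ext; simp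
  map_mul' a b := by ext; push_cast; group

/-- The conjugate representation `ρ^x`, `ρ^x(h) = ρ(x h x⁻¹)`. -/
def conjRep {k G V : Type*} [CommRing k] [Group G] {H : Subgroup G} (hN : H.Normal)
    [AddCommGroup V] [Module k V] (ρ : Representation k H V) (x : G) :
    Representation k H V :=
  ρ.comp (conjHom hN x)

theorem schur_aux {K V : Type*} [Group K] [AddCommGroup V] [Module ℂ V] [FiniteDimensional ℂ V]
    (r : Representation ℂ K V) (hirr : IsIrreducibleRep r) (T : Module.End ℂ V)
    (hT : ∀ h, T * r h = r h * T) : ∃ c : ℂ, T = c • 1 := by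
  obtain ⟨hne, hirr⟩ := hirr
  have : Nontrivial V := by
    by_contra hn
    rw [not_nontrivial_iff_subsingleton] at hn
    exact hne (Subsingleton.elim _ _)
  obtain ⟨c, hc⟩ := Module.End.exists_eigenvalue T
  refine ⟨c, ?_⟩
  have key := hirr (Module.End.eigenspace T c) (by
    intro g v hv
    rw [Module.End.mem_eigenspace_iff] at hv ⊢
    have := LinearMap.congr_fun (hT g) v
    simp only [Module.End.mul_apply] at this
    rw [this, hv, map_smul])
  rcases key with h | h
  · exact absurd h hc
  · ext v
    have : v ∈ Module.End.eigenspace T c := by rw [h]; trivial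
    rw [Module.End.mem_eigenspace_iff] at this
    simpa using this

theorem extend_aux {G E : Type*} [Group G] [Monoid E] (H : Subgroup G) (hH : H.index = 2)
    (x : G) (hx : x ∉ H) (R : G → E) (h1 : R 1 = 1)
    (hm : ∀ a ∈ H, ∀ b ∈ H, R (a * b) = R a * R b) (A : E) (hA : A * A = R (x * x))
    (hc : ∀ a ∈ H, A * R a = R (x * a * x⁻¹) * A) :
    ∃ f : G →* E, ∀ a ∈ H, f a = R a := by
  classical
  have mi : ∀ a b : G, a * b ∈ H ↔ (a ∈ H ↔ b ∈ H) :=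
    fun a b => Subgroup.mul_mem_iff_of_index_two hH
  refine ⟨⟨⟨fun g => if g ∈ H then R g else R (g * x⁻¹) * A, ?_⟩, ?_⟩, ?_⟩
  · simp [H.one_mem, h1]
  · intro a b
    by_cases ha : a ∈ H <;> by_cases hb : b ∈ H <;> simp only [mi, ha, hb, if_true, if_false,
      iff_true, iff_false, not_true, not_false_eq_true, true_iff]
    · exact hm a ha b hb
    · rw [mul_assoc a, hm a ha _ (by simp [mi, hb, hx]), mul_assoc]
    · rw [mul_assoc _ A, hc b hb, ← mul_assoc, ← hm _ (by simp [mi, ha, hx]) _ (by simp [mi, hb])]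
      congr 2; group
    · rw [mul_assoc _ A, ← mul_assoc A, hc _ (by simp [mi, hb, hx]), mul_assoc _ A A, hA,
        ← hm _ (by simp [mi, hb, hx]) _ (by simp [mi]), ← hm _ (by simp [mi, ha, hx]) _
        (by simp [mi, hb, hx])]
      congr 1; group
  · intro a ha
    simp [ha]

/-- Theorem 3.3, first part.  Let `H ≤ G` have index 2, `x ∈ G ∖ H`, and let
`(r, V)` be a finite-dimensional irreducible complex representation of `H`.  Then `r` extends
to a representation of `G` on `V` if and only if `r ≅ r^x`. -/
theorem extension_iff_iso_conj {G V : Type*} [Group G] (H : Subgroup G) (hH : H.index = 2)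
    (x : G) (hx : x ∉ H)
    [AddCommGroup V] [Module ℂ V] [FiniteDimensional ℂ V]
    (r : Representation ℂ H V) (hirr : IsIrreducibleRep r) :
    (∃ r₀ : Representation ℂ G V, ∀ h : H, r₀ ↑h = r h) ↔
      RepIso r (conjRep (normal_of_index_two hH) r x) := by
  classical
  constructor
  · rintro ⟨r₀, h₀⟩
    refine ⟨LinearEquiv.ofLinearMap (r₀ x) (r₀ x⁻¹) ?_ ?_, ?_⟩
    · change r₀ x * r₀ x⁻¹ = 1
      rw [← map_mul]; simp
    · change r₀ x⁻¹ * r₀ x = 1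
      rw [← map_mul]; simp
    · intro h v
      have : r₀ x * r h = r (conjHom (normal_of_index_two hH) x h) * r₀ x := by
        rw [← h₀, ← h₀, ← map_mul, ← map_mul]
        congr 1
        simp [conjHom]
      exact LinearMap.congr_fun this v
  · rintro ⟨e, he⟩
    set E : Module.End ℂ V := e.toLinearMap with hE
    have hN := normal_of_index_two hH
    have hEc : ∀ h : H, E * r h = r ⟨x * h * x⁻¹, hN.conj_mem h.1 h.2 x⟩ * E := by
      intro h; ext v; exact he h v
    have hxx : x * x ∈ H := Subgroup.mul_self_mem_of_index_two hH x
    set y : H := ⟨x * x, hxx⟩ with hy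
    have hEE : ∀ h : H, E * E * r h = r (y * h * y⁻¹) * (E * E) := by
      intro h
      rw [mul_assoc, hEc, ← mul_assoc, hEc, mul_assoc]
      congr 2
      ext; simp [hy, mul_assoc]
    obtain ⟨c, hc⟩ := schur_aux r hirr (r y⁻¹ * (E * E)) (by
      intro h
      rw [mul_assoc, hEE, ← mul_assoc (r _) (r _), ← mul_assoc (r _) (r _), ← map_mul, ← map_mul]
      congr 2
      group)
    have hc' : E * E = c • r y := by
      have : r y * (r y⁻¹ * (E * E)) = r y * (c • 1) := by rw [hc]
      rw [← mul_assoc, ← map_mul] at this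
      simpa using this
    have hc0 : c ≠ 0 := by
      rintro rfl
      apply hirr.1
      symm
      rw [Submodule.eq_bot_iff]
      intro v _
      have := LinearMap.congr_fun hc' v
      simpa [hE] using this
    obtain ⟨d, hd⟩ := IsAlgClosed.exists_pow_nat_eq c⁻¹ (n := 2) (by norm_num)
    obtain ⟨R, hR⟩ : ∃ R : G → Module.End ℂ V, ∀ a (ha : a ∈ H), R a = r ⟨a, ha⟩ :=
      ⟨fun g : G => if h : g ∈ H then r ⟨g, h⟩ else 0, by intro a ha; simp [ha]⟩
    obtain ⟨f, hf⟩ := extend_aux H hH x hx R (by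
        rw [hR 1 H.one_mem]; exact map_one r) (by
        intro a ha b hb
        rw [hR _ ha, hR _ hb, hR _ (H.mul_mem ha hb), ← map_mul]; rfl) (d • E) (by
        rw [hR _ hxx, smul_mul_smul_comm, hc', smul_smul, ← pow_two, hd, inv_mul_cancel₀ hc0,
          one_smul]) (by
        intro a ha
        rw [hR _ ha, hR _ (hN.conj_mem a ha x), smul_mul_assoc, mul_smul_comm, hEc ⟨a, ha⟩])
    exact ⟨f, fun h => (hf h h.2).trans (hR _ h.2)⟩
end

section
/- Let G be a group, H ≤ G a normal subgroup of index 2, M a commutative group (written multiplicatively), and ε : H → M a group homomorphism such that ε(g²) = 1 for all g ∈ G ∖ H and ε(g h g⁻¹) · ε(h) = 1 for all g ∈ G ∖ H and h ∈ H. Fix g' ∈ G ∖ H and define c : G × G → M by: c(a, b) = 1 if b ∈ H; c(a, b) = ε(a) if a ∈ H and b ∉ H; and c(a, b) = ε(g'⁻¹ a) if a ∉ H and b ∉ H. Then c is a 2-cocycle for the trivial action of G on M: c(a, b) · c(a b, d) = c(b, d) · c(a, b d) for all a, b, d ∈ G. -/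
open scoped Classical

/-- If `H` has index 2 and `g', a ∉ H`, then `g'⁻¹ * a ∈ H`. -/
theorem inv_mul_mem_of_index_two {G : Type*} [Group G] {H : Subgroup G}
    (hH : H.index = 2) {g' a : G} (hg' : g' ∉ H) (ha : a ∉ H) : g'⁻¹ * a ∈ H :=
  (Subgroup.mul_mem_iff_of_index_two hH).mpr
    (iff_of_false (fun h => hg' (H.inv_mem_iff.mp h)) ha)

/-- Let `H ⊴ G` be a normal subgroup of index 2, `M` a commutative group,
and `ε : H → M` a homomorphism with `ε(g²) = 1` for `g ∉ H` and `ε(ghg⁻¹)ε(h) = 1` for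
`g ∉ H`, `h ∈ H`.  Fix `g' ∉ H` and define `c(a,b) = 1` if `b ∈ H`, `c(a,b) = ε(a)` if
`a ∈ H, b ∉ H`, and `c(a,b) = ε(g'⁻¹a)` if `a, b ∉ H`.  Then `c` is a 2-cocycle for the
trivial action: `c(a,b)·c(ab,d) = c(b,d)·c(a,bd)` for all `a, b, d`. -/
theorem cocycle_of_epsilon {G M : Type*} [Group G] [CommGroup M]
    {H : Subgroup G} [hN : H.Normal] (hH : H.index = 2)
    (ε : H →* M)
    (hsq : ∀ g : G, (hg : g ∉ H) →
      ε ⟨g * g, Subgroup.mul_self_mem_of_index_two hH g⟩ = 1)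
    (hconj : ∀ g : G, g ∉ H → ∀ h : H,
      ε ⟨g * h * g⁻¹, hN.conj_mem h.1 h.2 g⟩ * ε h = 1)
    (g' : G) (hg' : g' ∉ H)
    (c : G → G → M)
    (hc : ∀ a b : G, c a b =
      if b ∈ H then 1
      else if ha : a ∈ H then ε ⟨a, ha⟩
      else ε ⟨g'⁻¹ * a, inv_mul_mem_of_index_two hH hg' ha⟩) :
    ∀ a b d : G, c a b * c (a * b) d = c b d * c a (b * d) := by
  have hm := fun a b : G => Subgroup.mul_mem_iff_of_index_two hH (a := a) (b := b)
  have key : ∀ (x y z : G) (hx : x ∈ H) (hy : y ∈ H) (hz : z ∈ H), z = x * y →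
      ε ⟨z, hz⟩ = ε ⟨x, hx⟩ * ε ⟨y, hy⟩ := by
    intro x y z hx hy hz h
    rw [← map_mul]
    congr 1
    exact Subtype.ext h
  have hgi : g'⁻¹ ∉ H := fun h => hg' (H.inv_mem_iff.mp h)
  intro a b d
  simp only [hc]
  by_cases hd : d ∈ H
  · by_cases hb : b ∈ H <;> simp [hm, hd, hb]
  · by_cases hb : b ∈ H
    · by_cases ha : a ∈ H
      · simp only [hm, hd, hb, ha, if_true, if_false, dite_true, one_mul, iff_true, iff_false,
          not_true, not_false_eq_true]
        rw [key a b _ ha hb _ rfl, mul_comm]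
      · simp only [hm, hd, hb, ha, if_true, if_false, dite_true, dite_false, one_mul, iff_true,
          iff_false, not_true, not_false_eq_true]
        rw [key (g'⁻¹ * a) b _ (inv_mul_mem_of_index_two hH hg' ha) hb _ (by group), mul_comm]
    · have hy := inv_mul_mem_of_index_two hH hg' hb
      by_cases ha : a ∈ H
      · simp only [hm, hd, hb, ha, if_true, if_false, dite_true, dite_false, mul_one, iff_true,
          iff_false, not_true, not_false_eq_true]
        have h1 := hconj g'⁻¹ hgi ⟨a, ha⟩
        rw [key (g'⁻¹ * a * g'⁻¹⁻¹) (g'⁻¹ * b) (g'⁻¹ * (a * b)) (hN.conj_mem a ha _) hy _ (by group),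
          ← mul_assoc, mul_comm (ε ⟨a, ha⟩), h1, one_mul]
      · simp only [hm, hd, hb, ha, if_true, if_false, dite_true, dite_false, mul_one, iff_true,
          iff_false, not_true, not_false_eq_true]
        have hx := inv_mul_mem_of_index_two hH hg' ha
        have h1 := hconj g' hg' ⟨_, hx⟩
        have h2 := Subgroup.mul_self_mem_of_index_two hH g'
        rw [key (g' * (g'⁻¹ * a) * g'⁻¹) (g' * g' * (g'⁻¹ * b)) (a * b) (hN.conj_mem _ hx _)
          (H.mul_mem h2 hy) _ (by group), key _ _ _ h2 hy _ rfl, hsq g' hg', one_mul,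
          ← mul_assoc, mul_comm (ε ⟨g'⁻¹ * a, hx⟩), h1, one_mul]
end

section
/- Let G be a group, H ≤ G a normal subgroup of index 2, M a commutative group, ε : H → M a group homomorphism with ε(g²) = 1 for all g ∈ G ∖ H and ε(g h g⁻¹) · ε(h) = 1 for all g ∈ G ∖ H and h ∈ H; fix g' ∈ G ∖ H and let c : G × G → M be given by c(a, b) = 1 if b ∈ H, c(a, b) = ε(a) if a ∈ H and b ∉ H, and c(a, b) = ε(g'⁻¹ a) if a ∉ H and b ∉ H. Suppose γ : G → M satisfies γ(a) · γ(b) = c(a, b) · γ(a b) for all a, b ∈ G (i.e., c is the coboundary of γ). Then: γ(1) = 1; the restriction of γ to H is a group homomorphism; and γ(h) = γ(g h g⁻¹) · ε(h) for every g ∈ G ∖ H and every h ∈ H. -/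
open scoped Classical

/-- With `H ⊴ G` normal of index 2, `ε : H → M` and `c` as in Statement 5,
suppose `γ : G → M` satisfies `γ(a)γ(b) = c(a,b)γ(ab)` for all `a, b` (i.e. `c` is the
coboundary of `γ`).  Then `γ(1) = 1`, the restriction of `γ` to `H` is a homomorphism, and
`γ(h) = γ(ghg⁻¹)·ε(h)` for every `g ∉ H` and `h ∈ H`. -/
theorem coboundary_properties {G M : Type*} [Group G] [CommGroup M]
    {H : Subgroup G} [hN : H.Normal] (hH : H.index = 2)
    (ε : H →* M)
    (hsq : ∀ g : G, (hg : g ∉ H) →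
      ε ⟨g * g, Subgroup.mul_self_mem_of_index_two hH g⟩ = 1)
    (hconj : ∀ g : G, g ∉ H → ∀ h : H,
      ε ⟨g * h * g⁻¹, hN.conj_mem h.1 h.2 g⟩ * ε h = 1)
    (g' : G) (hg' : g' ∉ H)
    (c : G → G → M)
    (hc : ∀ a b : G, c a b =
      if b ∈ H then 1
      else if ha : a ∈ H then ε ⟨a, ha⟩
      else ε ⟨g'⁻¹ * a, inv_mul_mem_of_index_two hH hg' ha⟩)
    (γ : G → M)
    (hγ : ∀ a b : G, γ a * γ b = c a b * γ (a * b)) :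
    γ 1 = 1 ∧
    (∀ h₁ h₂ : H, γ (↑h₁ * ↑h₂) = γ ↑h₁ * γ ↑h₂) ∧
    (∀ g : G, g ∉ H → ∀ h : H, γ ↑h = γ (g * ↑h * g⁻¹) * ε h) := by
  have key : ∀ a b : G, b ∈ H → γ a * γ b = γ (a * b) := by
    intro a b hb
    rw [hγ, hc, if_pos hb, one_mul]
  refine ⟨?_, fun h₁ h₂ => (key _ _ h₂.2).symm, ?_⟩
  · have h := key 1 1 H.one_mem
    rw [mul_one] at h
    exact mul_eq_left.mp h
  · intro g hg h
    have hk := hN.conj_mem h.1 h.2 g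
    have h1 := hγ (g * h * g⁻¹) g
    rw [hc, if_neg hg, dif_pos hk, inv_mul_cancel_right, ← key g h h.2] at h1
    have h2 : γ (g * h * g⁻¹) = ε ⟨g * h * g⁻¹, hk⟩ * γ h := by
      apply mul_right_cancel (b := γ g)
      rw [h1, mul_comm (γ g) (γ h)]; exact (mul_assoc _ _ _).symm
    rw [h2, mul_right_comm, hconj g hg h, one_mul]
end

section
/- Let (sₙ) and (tₙ) be sequences of real numbers with sₙ, tₙ ∈ [−2, 2] for all n, and suppose that as N → ∞: (1/N)·∑_{n<N}(sₙ + tₙ) → 0, (1/N)·∑_{n<N} sₙtₙ → −1, (1/N)·∑_{n<N}(sₙ² + tₙ²) → 3, (1/N)·∑_{n<N}(sₙ²tₙ + sₙtₙ²) → 0, and (1/N)·∑_{n<N} sₙ²tₙ² → 2. Then for every ε > 0, the set {n : sₙ + tₙ < −2/3 + ε} has positive upper density, and the set {n : sₙ + tₙ > 2/3 − ε} has positive upper density. -/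
open Filter
open scoped Classical

/-- The upper density of a set of natural numbers:
`limsup_{N→∞} #(S ∩ {0, …, N−1}) / N`. -/
noncomputable def upperDensity (S : Set ℕ) : ℝ :=
  limsup (fun N : ℕ =>
    (((Finset.range N).filter (fun n => n ∈ S)).card : ℝ) / N) atTop

theorem density_aux (S : Set ℕ) (f : ℕ → ℝ) (C c : ℝ) (hC : 0 < C) (hc : 0 < c)
    (hS : ∀ n, n ∈ S → -C ≤ f n) (hS' : ∀ n, n ∉ S → 0 ≤ f n)
    (hf : Tendsto (fun N : ℕ => (∑ n ∈ Finset.range N, f n) / N) atTop (nhds (-c))) :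
    0 < upperDensity S := by
  have hpos : 0 < c / 2 / C := by positivity
  refine lt_of_lt_of_le hpos ?_
  unfold upperDensity
  refine le_limsup_of_frequently_le ?_ ?_
  · apply Eventually.frequently
    have h := hf.eventually (gt_mem_nhds (show -c < -(c / 2) by linarith))
    filter_upwards [h, eventually_gt_atTop 0] with N hN hN0
    have hNR : (0 : ℝ) < N := by exact_mod_cast hN0
    have hsum : -C * (((Finset.range N).filter (fun n => n ∈ S)).card : ℝ)
        ≤ ∑ n ∈ Finset.range N, f n := by
      rw [Finset.card_filter]
      push_cast
      rw [Finset.mul_sum]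
      apply Finset.sum_le_sum
      intro n _
      by_cases hn : n ∈ S
      · simpa [hn] using hS n hn
      · simpa [hn] using hS' n hn
    rw [div_lt_iff₀ hNR] at hN
    rw [div_le_div_iff₀ hC hNR]
    nlinarith
  · refine isBoundedUnder_of ⟨1, fun N => ?_⟩
    refine div_le_one_of_le₀ ?_ (Nat.cast_nonneg N)
    have := Finset.card_filter_le (Finset.range N) (fun n => n ∈ S)
    rw [Finset.card_range] at this
    exact_mod_cast this

theorem lower_aux
    (s t : ℕ → ℝ)
    (hs : ∀ n, s n ∈ Set.Icc (-2 : ℝ) 2) (ht : ∀ n, t n ∈ Set.Icc (-2 : ℝ) 2)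
    (h1 : Tendsto (fun N : ℕ => (∑ n ∈ Finset.range N, (s n + t n)) / N) atTop (nhds 0))
    (h2 : Tendsto (fun N : ℕ => (∑ n ∈ Finset.range N, s n * t n) / N) atTop (nhds (-1)))
    (h3 : Tendsto (fun N : ℕ => (∑ n ∈ Finset.range N, (s n ^ 2 + t n ^ 2)) / N) atTop (nhds 3))
    (h4 : Tendsto (fun N : ℕ => (∑ n ∈ Finset.range N, (s n ^ 2 * t n + s n * t n ^ 2)) / N)
      atTop (nhds 0)) (ε : ℝ) (hε : 0 < ε) :
    0 < upperDensity {n | s n + t n < -2/3 + ε} := by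
  have hL : ∀ n, 0 ≤ (2 - s n) * (2 - t n) := fun n =>
    mul_nonneg (by linarith [(hs n).2]) (by linarith [(ht n).2])
  have hL' : ∀ n, (2 - s n) * (2 - t n) ≤ 16 := fun n => by
    have := (hs n).1
    have := (hs n).2
    have := (ht n).1
    have := (ht n).2
    nlinarith
  refine density_aux _ (fun n => (s n + t n + (2/3 - ε)) * ((2 - s n) * (2 - t n)))
    ((4 + ε) * 16) (3 * ε) (by positivity) (by positivity) ?_ ?_ ?_
  · intro n _
    have a : -(4 + ε) ≤ s n + t n + (2/3 - ε) := by linarith [(hs n).1, (ht n).1]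
    have := mul_le_mul_of_nonneg_right a (hL n)
    have := mul_le_mul_of_nonneg_left (hL' n) (show 0 ≤ 4 + ε by linarith)
    linarith
  · intro n hn
    simp only [Set.mem_setOf_eq, not_lt] at hn
    exact mul_nonneg (by linarith) (hL n)
  · have h0 : Tendsto (fun N : ℕ => (∑ n ∈ Finset.range N, (1 : ℝ)) / N) atTop (nhds 1) := by
      refine tendsto_const_nhds.congr' ?_
      filter_upwards [eventually_gt_atTop 0] with N hN
      have : (N : ℝ) ≠ 0 := by exact_mod_cast hN.ne'
      simp [this]
    have key := ((((h1.const_mul (4 - 2 * (2/3 - ε))).add h4).add (h3.const_mul (-2))).add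
      (h2.const_mul ((2/3 - ε) - 4))).add (h0.const_mul (4 * (2/3 - ε)))
    convert key using 1
    · funext N
      simp only [← mul_div_assoc, ← add_div, Finset.mul_sum, ← Finset.sum_add_distrib]
      congr 1
      apply Finset.sum_congr rfl
      intro n _
      ring
    · congr 1
      ring

/-- analytic content of Theorem 4.1.  If `sₙ, tₙ ∈ [−2, 2]` satisfy the five
Cesàro moment asymptotics, then for every `ε > 0` the sets
`{n : sₙ + tₙ < −2/3 + ε}` and `{n : sₙ + tₙ > 2/3 − ε}` have positive upper density. -/
theorem trace_asymptotics_generic_a1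
    (s t : ℕ → ℝ)
    (hs : ∀ n, s n ∈ Set.Icc (-2 : ℝ) 2) (ht : ∀ n, t n ∈ Set.Icc (-2 : ℝ) 2)
    (h1 : Tendsto (fun N => (∑ n ∈ Finset.range N, (s n + t n)) / N) atTop (nhds 0))
    (h2 : Tendsto (fun N => (∑ n ∈ Finset.range N, s n * t n) / N) atTop (nhds (-1)))
    (h3 : Tendsto (fun N => (∑ n ∈ Finset.range N, (s n ^ 2 + t n ^ 2)) / N) atTop (nhds 3))
    (h4 : Tendsto (fun N => (∑ n ∈ Finset.range N, (s n ^ 2 * t n + s n * t n ^ 2)) / N)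
      atTop (nhds 0))
    (h5 : Tendsto (fun N => (∑ n ∈ Finset.range N, s n ^ 2 * t n ^ 2) / N) atTop (nhds 2)) :
    ∀ ε : ℝ, 0 < ε →
      0 < upperDensity {n | s n + t n < -2/3 + ε} ∧
      0 < upperDensity {n | s n + t n > 2/3 - ε} := by
  intro ε hε
  refine ⟨lower_aux s t hs ht h1 h2 h3 h4 ε hε, ?_⟩
  have := lower_aux (fun n => - s n) (fun n => - t n)
    (fun n => ⟨by linarith [(hs n).2], by linarith [(hs n).1]⟩)
    (fun n => ⟨by linarith [(ht n).2], by linarith [(ht n).1]⟩)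
    (by
      convert h1.neg using 1
      · funext N
        rw [← neg_div, ← Finset.sum_neg_distrib]
        congr 1
        exact Finset.sum_congr rfl fun n _ => by ring
      · simp)
    (by simpa using h2) (by simpa using h3)
    (by
      convert h4.neg using 1
      · funext N
        rw [← neg_div, ← Finset.sum_neg_distrib]
        congr 1
        exact Finset.sum_congr rfl fun n _ => by ring
      · simp) ε hε
  convert this using 2
  ext n
  simp only [Set.mem_setOf_eq]
  constructor <;> intro h <;> linarith
end

section
/- Let (sₙ) and (tₙ) be sequences of real numbers with sₙ, tₙ ∈ [−2, 2] for all n, and suppose that as N → ∞: (1/N)·∑_{n<N}(sₙ + tₙ) → 0, (1/N)·∑_{n<N} sₙtₙ → −1, (1/N)·∑_{n<N}(sₙ² + tₙ²) → 3, (1/N)·∑_{n<N}(sₙ²tₙ + sₙtₙ²) → 0, and (1/N)·∑_{n<N} sₙ²tₙ² → 2. Then for every ε > 0, the set {n : sₙtₙ > −2/3 − ε} has positive upper density, and the set {n : sₙtₙ < −6/5 + ε} has positive upper density. -/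
open Filter
open scoped Classical

lemma upperDensity_pos_aux (S : Set ℕ) (f : ℕ → ℝ) (C L : ℝ) (hC : 0 < C) (hL : 0 < L)
    (hf : ∀ n, f n ≤ C) (hS : ∀ n, n ∉ S → f n ≤ 0)
    (h : Tendsto (fun N : ℕ => (∑ n ∈ Finset.range N, f n) / N) atTop (nhds L)) :
    0 < upperDensity S := by
  have key : L / 2 / C ≤ upperDensity S := by
    unfold upperDensity
    apply le_limsup_of_frequently_le
    · apply Eventually.frequently
      filter_upwards [h.eventually (lt_mem_nhds (half_lt_self hL))] with N hN
      rw [div_le_iff₀ hC]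
      refine hN.le.trans ?_
      rw [div_mul_eq_mul_div]
      apply div_le_div_of_nonneg_right _ (Nat.cast_nonneg N)
      calc ∑ n ∈ Finset.range N, f n
          ≤ ∑ n ∈ Finset.range N, (if n ∈ S then C else 0) := by
            apply Finset.sum_le_sum
            intro n _
            split_ifs with hn
            · exact hf n
            · exact hS n hn
        _ = _ := by
            rw [← Finset.sum_filter, Finset.sum_const, nsmul_eq_mul]
    · refine isBoundedUnder_of ⟨1, fun N => ?_⟩
      apply div_le_one_of_le₀ _ (Nat.cast_nonneg N)
      have := Finset.card_filter_le (Finset.range N) (fun n => n ∈ S)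
      rw [Finset.card_range] at this
      exact_mod_cast this
  exact lt_of_lt_of_le (by positivity) key

lemma avg_quad (u : ℕ → ℝ) (a b : ℝ)
    (h2 : Tendsto (fun N : ℕ => (∑ n ∈ Finset.range N, u n) / N) atTop (nhds (-1)))
    (h5 : Tendsto (fun N : ℕ => (∑ n ∈ Finset.range N, u n ^ 2) / N) atTop (nhds 2)) :
    Tendsto (fun N : ℕ => (∑ n ∈ Finset.range N, (u n - a) * (u n - b)) / N) atTop
      (nhds (2 + (a + b) + a * b)) := by
  have h := (h5.sub (h2.const_mul (a + b))).add_const (a * b)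
  have e : 2 - (a + b) * (-1) + a * b = 2 + (a + b) + a * b := by ring
  rw [e] at h
  refine h.congr' ?_
  filter_upwards [eventually_gt_atTop 0] with N hN
  have hN' : (N : ℝ) ≠ 0 := by positivity
  have : ∑ n ∈ Finset.range N, (u n - a) * (u n - b)
      = ∑ n ∈ Finset.range N, u n ^ 2 - (a + b) * ∑ n ∈ Finset.range N, u n + N * (a * b) := by
    have e2 : ∀ n, (u n - a) * (u n - b) = u n ^ 2 - (a + b) * u n + a * b := fun n => by ring
    simp only [e2, Finset.sum_add_distrib, Finset.sum_sub_distrib, Finset.mul_sum,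
      Finset.sum_const, Finset.card_range, nsmul_eq_mul]
  rw [this]
  field_simp

/-- analytic content of Theorem 4.2.  If `sₙ, tₙ ∈ [−2, 2]` satisfy the five
Cesàro moment asymptotics, then for every `ε > 0` the sets
`{n : sₙtₙ > −2/3 − ε}` and `{n : sₙtₙ < −6/5 + ε}` have positive upper density. -/
theorem trace_asymptotics_generic_a2
    (s t : ℕ → ℝ)
    (hs : ∀ n, s n ∈ Set.Icc (-2 : ℝ) 2) (ht : ∀ n, t n ∈ Set.Icc (-2 : ℝ) 2)
    (h1 : Tendsto (fun N => (∑ n ∈ Finset.range N, (s n + t n)) / N) atTop (nhds 0))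
    (h2 : Tendsto (fun N => (∑ n ∈ Finset.range N, s n * t n) / N) atTop (nhds (-1)))
    (h3 : Tendsto (fun N => (∑ n ∈ Finset.range N, (s n ^ 2 + t n ^ 2)) / N) atTop (nhds 3))
    (h4 : Tendsto (fun N => (∑ n ∈ Finset.range N, (s n ^ 2 * t n + s n * t n ^ 2)) / N)
      atTop (nhds 0))
    (h5 : Tendsto (fun N => (∑ n ∈ Finset.range N, s n ^ 2 * t n ^ 2) / N) atTop (nhds 2)) :
    ∀ ε : ℝ, 0 < ε →
      0 < upperDensity {n | s n * t n > -2/3 - ε} ∧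
      0 < upperDensity {n | s n * t n < -6/5 + ε} := by
  intro ε hε
  have hu : ∀ n, -4 ≤ s n * t n ∧ s n * t n ≤ 4 := by
    intro n
    obtain ⟨a, b⟩ := hs n
    obtain ⟨c, d⟩ := ht n
    constructor <;> nlinarith
  have h5' : Tendsto (fun N : ℕ => (∑ n ∈ Finset.range N, (s n * t n) ^ 2) / N) atTop
      (nhds 2) := by
    simpa only [mul_pow] using h5
  constructor
  · refine upperDensity_pos_aux _ _ (8 * (5 + ε)) _ (by positivity) ?_ ?_ ?_
      (avg_quad (fun n => s n * t n) (-4) (-2/3 - ε) h2 h5')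
    · linarith
    · intro n
      obtain ⟨a, b⟩ := hu n
      change (s n * t n - -4) * (s n * t n - (-2/3 - ε)) ≤ _
      generalize s n * t n = u at *
      nlinarith
    · intro n hn
      obtain ⟨a, b⟩ := hu n
      rw [Set.mem_setOf_eq, not_lt] at hn
      exact mul_nonpos_of_nonneg_of_nonpos (by linarith) (by linarith)
  · refine upperDensity_pos_aux _ _ (8 * (6 + ε)) _ (by positivity) ?_ ?_ ?_
      (avg_quad (fun n => s n * t n) 4 (-6/5 + ε) h2 h5')
    · linarith
    · intro n
      obtain ⟨a, b⟩ := hu n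
      change (s n * t n - 4) * (s n * t n - (-6/5 + ε)) ≤ _
      generalize s n * t n = u at *
      nlinarith
    · intro n hn
      obtain ⟨a, b⟩ := hu n
      rw [Set.mem_setOf_eq, not_lt] at hn
      exact mul_nonpos_of_nonpos_of_nonneg (by linarith) (by linarith)
end

section
/- Let (xₙ) and (yₙ) be sequences of real numbers with xₙ, yₙ ∈ [−2, 2] for all n. Suppose that for every pair (k, l) of natural numbers with either (k ≤ 4 and l ≤ 4) or (min(k,l) = 0 and max(k,l) ≤ 8), the averages (1/N)·∑_{n<N} xₙᵏ yₙˡ converge as N → ∞ to C_{k/2}·C_{l/2} if k and l are both even, and to 0 if k or l is odd. Then the set {n : xₙ + yₙ < −2.47} has positive upper density, and the set {n : xₙ + yₙ > 2.47} has positive upper density. -/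
open Filter
open scoped Classical

def cf : List (ℕ × ℕ × ℤ) :=
  [(0, 0, 34508470349056),
   (0, 1, -21389672948480),
   (0, 2, 191844325276928),
   (0, 3, 173024290836160),
   (0, 4, 4405502255136),
   (0, 5, 6655221468816),
   (0, 6, -38780207391084),
   (0, 7, -15873847604400),
   (0, 8, 12202421374200),
   (1, 0, -21389672948480),
   (1, 1, 614641910094720),
   (1, 2, 1055769755131136),
   (1, 3, 55967286741920),
   (1, 4, -277118848350384),
   (2, 0, 191844882761472),
   (2, 1, 1055769265617536),
   (2, 2, 885955766690384),
   (2, 3, -403127768207152),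
   (2, 4, -341509717812388),
   (3, 0, 173023485704256),
   (3, 1, 55965992519296),
   (3, 2, -403127503492240),
   (3, 3, -409253476054936),
   (3, 4, -64767393634000),
   (4, 0, 4404763396800),
   (4, 1, -277118592307120),
   (4, 2, -341509158440000),
   (4, 3, -64767405996800),
   (4, 4, 22366627385400),
   (5, 0, 6655608909104),
   (6, 0, -38780166800408),
   (7, 0, -15873885340000),
   (8, 0, 12202462883800)]

noncomputable def ev (L : List (ℕ × ℕ × ℤ)) (a b : ℝ) : ℝ :=
  (L.map fun p => (p.2.2 : ℝ) * (a ^ p.1 * b ^ p.2.1)).sum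

def mm (k l : ℕ) : ℝ :=
  if k % 2 = 0 ∧ l % 2 = 0 then (catalan (k / 2) : ℝ) * catalan (l / 2) else 0

lemma mono_bd (u v : ℝ) (hu : |u| ≤ 1) (hv : |v| ≤ 1) (k l : ℕ) :
    -1 ≤ u ^ k * v ^ l ∧ u ^ k * v ^ l ≤ 1 := by
  rw [← abs_le, abs_mul, abs_pow, abs_pow]
  exact mul_le_one₀ (pow_le_one₀ (abs_nonneg _) hu) (by positivity)
    (pow_le_one₀ (abs_nonneg _) hv)

lemma sos0 (u v : ℝ) : 0 ≤
    (23957 + 38998*u + 38998*v - 113184*u^2 + 220297*u*v - 113184*v^2 - 52079*u^3 - 51861*u^2*v - 51861*u*v^2 - 52079*v^3 + 180621*u^4 - 157062*u^3*v - 199685*u^2*v^2 - 157062*u*v^3 + 180621*v^4)^2 +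
    (47123*u + 37500*v - 6365*u^2 + 123885*u*v + 54053*v^2 - 73780*u^3 - 78501*u^2*v - 40634*u*v^2 - 35762*v^3 + 44702*u^4 - 75715*u^3*v - 161235*u^2*v^2 - 177505*u*v^3 - 59729*v^4)^2 +
    (28536*v + 97622*u^2 + 41776*u*v - 81541*v^2 + 37899*u^3 + 36059*u^2*v - 76234*u*v^2 - 74839*v^3 - 157374*u^4 - 193620*u^3*v - 54372*u^2*v^2 + 108229*u*v^3 + 152306*v^4)^2 +
    (23880*u^2 + 1411*u*v - 16269*v^2 + 6745*u^3 + 10356*u^2*v - 11625*u*v^2 - 6294*v^3 - 39283*u^4 - 31000*u^3*v - 572*u^2*v^2 + 23580*u*v^3 + 26188*v^4)^2 +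
    (20038*u*v + 2827*v^2 - 145*u^3 - 2527*u^2*v - 979*u*v^2 + 773*v^3 + 2755*u^4 - 17195*u^3*v - 16813*u^2*v^2 - 21038*u*v^3 - 1855*v^4)^2 +
    (17251*v^2 - 2328*u^3 - 5912*u^2*v + 3533*u*v^2 + 3274*v^3 - 1247*u^4 + 6224*u^3*v + 1425*u^2*v^2 - 17227*u*v^3 - 29377*v^4)^2 +
    (5653*u^3 + 4893*u^2*v - 6797*u*v^2 - 2827*v^3 - 973*u^4 + 643*u^3*v + 1803*u^2*v^2 - 1117*u*v^3 - 191*v^4)^2 +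
    (7591*u^2*v - 1264*u*v^2 - 3240*v^3 + 1141*u^4 + 3317*u^3*v - 2397*u^2*v^2 - 2365*u*v^3 + 541*v^4)^2 +
    (5811*u*v^2 + 749*v^3 - 344*u^4 - 2556*u^3*v - 26*u^2*v^2 + 3053*u*v^3 + 566*v^4)^2 +
    (3593*v^3 + 35*u^4 + 2272*u^3*v + 2099*u^2*v^2 - 2635*u*v^3 - 1311*v^4)^2 +
    (8298*u^4 + 13965*u^3*v - 7612*u^2*v^2 - 12318*u*v^3 - 1911*v^4)^2 +
    (14801*u^3*v + 6608*u^2*v^2 - 14135*u*v^3 - 5103*v^4)^2 +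
    (10736*u^2*v^2 - 826*u*v^3 - 4098*v^4)^2 +
    (7866*u*v^3 + 2139*v^4)^2 +
    (4219*v^4)^2 := by
  positivity

lemma sos1 (u v : ℝ) : 0 ≤
    (8919 - 119135*u - 119135*v - 164357*u^2 - 437665*u*v - 164357*v^2 + 40283*u^3 - 328701*u^2*v - 328701*u*v^2 + 40283*v^3)^2 +
    (22705*u + 21791*v + 26447*u^2 + 76150*u*v + 26531*v^2 - 10155*u^3 + 55042*u^2*v + 56005*u*v^2 - 8090*v^3)^2 +
    (6376*v + 4089*u^2 + 10911*u*v + 3502*v^2 + 5900*u^3 + 11318*u^2*v + 4593*u*v^2 - 8514*v^3)^2 +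
    (6009*u^2 + 11595*u*v + 3081*v^2 + 4877*u^3 + 13288*u^2*v + 10707*u*v^2 + 2304*v^3)^2 +
    (8720*u*v + 3894*v^2 - 239*u^3 + 6316*u^2*v + 9748*u*v^2 + 3182*v^3)^2 +
    (3385*v^2 - 73*u^3 - 352*u^2*v + 2631*u*v^2 + 2900*v^3)^2 +
    (5129*u^3 + 4175*u^2*v - 5923*u*v^2 - 2602*v^3)^2 +
    (6568*u^2*v - 913*u*v^2 - 2972*v^3)^2 +
    (4966*u*v^2 + 663*v^3)^2 +
    (3205*v^3)^2 := by
  positivity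

set_option maxHeartbeats 4000000 in
lemma key (u v : ℝ) (hu : |u| ≤ 1) (hv : |v| ≤ 1) (h : u + v ≤ 247 / 200) :
    0 ≤ 134798712301 - 167106819910*(v) + 2997567582452*(v^2) + 5407009088630*(v^3) + 275343890946*(v^4) + 831902683602*(v^5) - 9695051847771*(v^6) - 7936923802200*(v^7) + 12202421374200*(v^8) - 167106819910*(u) + 9603779845230*(u*v) + 32992804847848*(u*v^2) + 3497955421370*(u*v^3) - 34639856043798*(u*v^4) + 2997576293148*(u^2) + 32992789550548*(u^2*v) + 55372235418149*(u^2*v^2) - 50390971025894*(u^2*v^3) - 85377429453097*(u^2*v^4) + 5406983928258*(u^3) + 3497874532456*(u^3*v) - 50390937936530*(u^3*v^2) - 102313369013734*(u^3*v^3) - 32383696817000*(u^3*v^4) + 275297712300*(u^4) - 34639824038390*(u^4*v) - 85377289610000*(u^4*v^2) - 32383702998400*(u^4*v^3) + 22366627385400*(u^4*v^4) + 831951113638*(u^5) - 9695041700102*(u^6) - 7936942670000*(u^7) + 12202462883800*(u^8) := by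
  have h0 := sos0 u v
  have h1 := mul_nonneg (show (0:ℝ) ≤ 247 - 200*u - 200*v by linarith) (sos1 u v)
  have hR : - 41979914*(u*v^5) - 29321000*(u*v^6) + 16046400*(u*v^7) + 41830600*(u^2*v^5) - 7126800*(u^2*v^6) - 6402000*(u^3*v^5) + 82449620*(u^5*v) + 26568000*(u^5*v^2) - 42440800*(u^5*v^3) - 27309200*(u^6*v) - 7050800*(u^6*v^2) + 34122800*(u^7*v) ≤ 362647934 := by
    have r15 := mono_bd u v hu hv 1 5
    have r16 := mono_bd u v hu hv 1 6
    have r17 := mono_bd u v hu hv 1 7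
    have r25 := mono_bd u v hu hv 2 5
    have r26 := mono_bd u v hu hv 2 6
    have r35 := mono_bd u v hu hv 3 5
    have r51 := mono_bd u v hu hv 5 1
    have r52 := mono_bd u v hu hv 5 2
    have r53 := mono_bd u v hu hv 5 3
    have r61 := mono_bd u v hu hv 6 1
    have r62 := mono_bd u v hu hv 6 2
    have r71 := mono_bd u v hu hv 7 1
    linarith
  generalize hA : (23957 + 38998*u + 38998*v - 113184*u^2 + 220297*u*v - 113184*v^2 - 52079*u^3 - 51861*u^2*v - 51861*u*v^2 - 52079*v^3 + 180621*u^4 - 157062*u^3*v - 199685*u^2*v^2 - 157062*u*v^3 + 180621*v^4)^2 +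
    (47123*u + 37500*v - 6365*u^2 + 123885*u*v + 54053*v^2 - 73780*u^3 - 78501*u^2*v - 40634*u*v^2 - 35762*v^3 + 44702*u^4 - 75715*u^3*v - 161235*u^2*v^2 - 177505*u*v^3 - 59729*v^4)^2 +
    (28536*v + 97622*u^2 + 41776*u*v - 81541*v^2 + 37899*u^3 + 36059*u^2*v - 76234*u*v^2 - 74839*v^3 - 157374*u^4 - 193620*u^3*v - 54372*u^2*v^2 + 108229*u*v^3 + 152306*v^4)^2 +
    (23880*u^2 + 1411*u*v - 16269*v^2 + 6745*u^3 + 10356*u^2*v - 11625*u*v^2 - 6294*v^3 - 39283*u^4 - 31000*u^3*v - 572*u^2*v^2 + 23580*u*v^3 + 26188*v^4)^2 +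
    (20038*u*v + 2827*v^2 - 145*u^3 - 2527*u^2*v - 979*u*v^2 + 773*v^3 + 2755*u^4 - 17195*u^3*v - 16813*u^2*v^2 - 21038*u*v^3 - 1855*v^4)^2 +
    (17251*v^2 - 2328*u^3 - 5912*u^2*v + 3533*u*v^2 + 3274*v^3 - 1247*u^4 + 6224*u^3*v + 1425*u^2*v^2 - 17227*u*v^3 - 29377*v^4)^2 +
    (5653*u^3 + 4893*u^2*v - 6797*u*v^2 - 2827*v^3 - 973*u^4 + 643*u^3*v + 1803*u^2*v^2 - 1117*u*v^3 - 191*v^4)^2 +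
    (7591*u^2*v - 1264*u*v^2 - 3240*v^3 + 1141*u^4 + 3317*u^3*v - 2397*u^2*v^2 - 2365*u*v^3 + 541*v^4)^2 +
    (5811*u*v^2 + 749*v^3 - 344*u^4 - 2556*u^3*v - 26*u^2*v^2 + 3053*u*v^3 + 566*v^4)^2 +
    (3593*v^3 + 35*u^4 + 2272*u^3*v + 2099*u^2*v^2 - 2635*u*v^3 - 1311*v^4)^2 +
    (8298*u^4 + 13965*u^3*v - 7612*u^2*v^2 - 12318*u*v^3 - 1911*v^4)^2 +
    (14801*u^3*v + 6608*u^2*v^2 - 14135*u*v^3 - 5103*v^4)^2 +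
    (10736*u^2*v^2 - 826*u*v^3 - 4098*v^4)^2 +
    (7866*u*v^3 + 2139*v^4)^2 +
    (4219*v^4)^2 = A at h0
  generalize hB : (247 - 200*u - 200*v) * (
    (8919 - 119135*u - 119135*v - 164357*u^2 - 437665*u*v - 164357*v^2 + 40283*u^3 - 328701*u^2*v - 328701*u*v^2 + 40283*v^3)^2 +
    (22705*u + 21791*v + 26447*u^2 + 76150*u*v + 26531*v^2 - 10155*u^3 + 55042*u^2*v + 56005*u*v^2 - 8090*v^3)^2 +
    (6376*v + 4089*u^2 + 10911*u*v + 3502*v^2 + 5900*u^3 + 11318*u^2*v + 4593*u*v^2 - 8514*v^3)^2 +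
    (6009*u^2 + 11595*u*v + 3081*v^2 + 4877*u^3 + 13288*u^2*v + 10707*u*v^2 + 2304*v^3)^2 +
    (8720*u*v + 3894*v^2 - 239*u^3 + 6316*u^2*v + 9748*u*v^2 + 3182*v^3)^2 +
    (3385*v^2 - 73*u^3 - 352*u^2*v + 2631*u*v^2 + 2900*v^3)^2 +
    (5129*u^3 + 4175*u^2*v - 5923*u*v^2 - 2602*v^3)^2 +
    (6568*u^2*v - 913*u*v^2 - 2972*v^3)^2 +
    (4966*u*v^2 + 663*v^3)^2 +
    (3205*v^3)^2) = B at h1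
  have hid : 134798712301 - 167106819910*(v) + 2997567582452*(v^2) + 5407009088630*(v^3) + 275343890946*(v^4) + 831902683602*(v^5) - 9695051847771*(v^6) - 7936923802200*(v^7) + 12202421374200*(v^8) - 167106819910*(u) + 9603779845230*(u*v) + 32992804847848*(u*v^2) + 3497955421370*(u*v^3) - 34639856043798*(u*v^4) + 2997576293148*(u^2) + 32992789550548*(u^2*v) + 55372235418149*(u^2*v^2) - 50390971025894*(u^2*v^3) - 85377429453097*(u^2*v^4) + 5406983928258*(u^3) + 3497874532456*(u^3*v) - 50390937936530*(u^3*v^2) - 102313369013734*(u^3*v^3) - 32383696817000*(u^3*v^4) + 275297712300*(u^4) - 34639824038390*(u^4*v) - 85377289610000*(u^4*v^2) - 32383702998400*(u^4*v^3) + 22366627385400*(u^4*v^4) + 831951113638*(u^5) - 9695041700102*(u^6) - 7936942670000*(u^7) + 12202462883800*(u^8) = 200 * A + B + (362647934 - (- 41979914*(u*v^5) - 29321000*(u*v^6) + 16046400*(u*v^7) + 41830600*(u^2*v^5) - 7126800*(u^2*v^6) - 6402000*(u^3*v^5) + 82449620*(u^5*v) + 26568000*(u^5*v^2) - 42440800*(u^5*v^3)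 - 27309200*(u^6*v) - 7050800*(u^6*v^2) + 34122800*(u^7*v))) := by
    rw [← hA, ← hB]
    ring
  rw [hid]
  linarith

lemma key2 (a b : ℝ) (ha : a ∈ Set.Icc (-2 : ℝ) 2) (hb : b ∈ Set.Icc (-2 : ℝ) 2)
    (h : a + b ≤ 2.47) : 0 ≤ ev cf a b := by
  have h1 := key (a / 2) (b / 2) (by rw [abs_le]; constructor <;> linarith [ha.1, ha.2])
    (by rw [abs_le]; constructor <;> linarith [hb.1, hb.2]) (by norm_num at h; linarith)
  simp only [ev, cf, List.map_cons, List.map_nil, List.sum_cons, List.sum_nil]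
  push_cast
  linarith

lemma cat4 : catalan 4 = 14 := by
  rw [catalan_eq_centralBinom_div]; rfl

lemma lim_neg : (cf.map fun p => (p.2.2 : ℝ) * mm p.1 p.2.1).sum < 0 := by
  simp only [mm, cf, List.map_cons, List.map_nil, List.sum_cons, List.sum_nil]
  norm_num [catalan_zero, catalan_one, catalan_two, catalan_three, cat4]

lemma ev_lower (L : List (ℕ × ℕ × ℤ)) : ∃ M : ℝ, 0 < M ∧ ∀ a b : ℝ, a ∈ Set.Icc (-2 : ℝ) 2 →
    b ∈ Set.Icc (-2 : ℝ) 2 → -M ≤ ev L a b := by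
  have hc : Continuous fun p : ℝ × ℝ => ev L p.1 p.2 := by
    unfold ev
    induction L with
    | nil => simpa using continuous_const
    | cons p L ih =>
      simp only [List.map_cons, List.sum_cons]
      exact Continuous.add (by fun_prop) ih
  have hK : IsCompact (Set.Icc (-2 : ℝ) 2 ×ˢ Set.Icc (-2 : ℝ) 2) :=
    isCompact_Icc.prod isCompact_Icc
  obtain ⟨C, hC⟩ := hK.exists_bound_of_continuousOn hc.continuousOn
  refine ⟨|C| + 1, by positivity, fun a b ha hb => ?_⟩
  have := hC (a, b) ⟨ha, hb⟩
  simp only [Real.norm_eq_abs] at this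
  have h2 := (abs_le.1 this).1
  linarith [le_abs_self C]

lemma ev_tendsto (x y : ℕ → ℝ) (L : List (ℕ × ℕ × ℤ))
    (h : ∀ p ∈ L, Tendsto (fun N : ℕ => (∑ n ∈ Finset.range N, x n ^ p.1 * y n ^ p.2.1) / N)
      atTop (nhds (mm p.1 p.2.1))) :
    Tendsto (fun N : ℕ => (∑ n ∈ Finset.range N, ev L (x n) (y n)) / N) atTop
      (nhds (L.map fun p => (p.2.2 : ℝ) * mm p.1 p.2.1).sum) := by
  induction L with
  | nil => simp [ev]
  | cons p L ih =>
    have h1 := (h p (by simp)).const_mul (p.2.2 : ℝ)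
    have h2 := ih (fun q hq => h q (by simp [hq]))
    simp only [List.map_cons, List.sum_cons]
    refine (h1.add h2).congr fun N => ?_
    simp only [ev, List.map_cons, List.sum_cons, Finset.sum_add_distrib, ← Finset.mul_sum]
    ring

lemma upper (x y : ℕ → ℝ)
    (hx : ∀ n, x n ∈ Set.Icc (-2 : ℝ) 2) (hy : ∀ n, y n ∈ Set.Icc (-2 : ℝ) 2)
    (hmom : ∀ k l : ℕ, ((k ≤ 4 ∧ l ≤ 4) ∨ (min k l = 0 ∧ max k l ≤ 8)) →
      Tendsto (fun N : ℕ => (∑ n ∈ Finset.range N, x n ^ k * y n ^ l) / N) atTop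
        (nhds (mm k l))) :
    0 < upperDensity {n | x n + y n > 2.47} := by
  have hlim := ev_tendsto x y cf (fun p hp => hmom p.1 p.2.1 (by
    revert p; decide))
  obtain ⟨M, hM, hMb⟩ := ev_lower cf
  set e := (cf.map fun p => (p.2.2 : ℝ) * mm p.1 p.2.1).sum with he
  have hneg : e < 0 := lim_neg
  have hev : ∀ᶠ N : ℕ in atTop, -(e / 2) / M ≤
      (((Finset.range N).filter (fun n => n ∈ {n | x n + y n > 2.47})).card : ℝ) / N := by
    filter_upwards [hlim.eventually (gt_mem_nhds (show e < e / 2 by linarith)),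
      eventually_gt_atTop 0] with N hN hN0
    have hNpos : (0 : ℝ) < N := by exact_mod_cast hN0
    have hsum : -M * (((Finset.range N).filter
        (fun n => n ∈ {n | x n + y n > 2.47})).card : ℝ) ≤
        ∑ n ∈ Finset.range N, ev cf (x n) (y n) := by
      rw [Finset.card_filter]
      push_cast
      rw [Finset.mul_sum]
      refine Finset.sum_le_sum fun n _ => ?_
      by_cases hn : n ∈ {n | x n + y n > 2.47}
      · rw [if_pos hn]
        linarith [hMb _ _ (hx n) (hy n)]
      · rw [if_neg hn]
        have := key2 _ _ (hx n) (hy n) (not_lt.1 hn)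
        linarith
    rw [div_lt_iff₀ hNpos] at hN
    have fin : ∀ c : ℝ, -M * c ≤ ∑ n ∈ Finset.range N, ev cf (x n) (y n) →
        -(e / 2) / M ≤ c / N := by
      intro c hc
      rw [div_le_div_iff₀ hM hNpos]
      linarith
    exact fin _ hsum
  have hpos : 0 < -(e / 2) / M := div_pos (by linarith) hM
  refine lt_of_lt_of_le hpos ?_
  refine le_limsup_of_frequently_le hev.frequently ?_
  refine isBoundedUnder_of ⟨1, fun N => ?_⟩
  refine div_le_one_of_le₀ ?_ (by positivity)
  have := Finset.card_filter_le (Finset.range N) (fun n => n ∈ {n | x n + y n > 2.47})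
  rw [Finset.card_range] at this
  exact_mod_cast this

/-- analytic content of Theorem 4.3.  If `xₙ, yₙ ∈ [−2, 2]` satisfy the
Catalan-number moment asymptotics
`(1/N)·∑_{n<N} xₙᵏ yₙˡ → C_{k/2}·C_{l/2}` (`k, l` both even) or `→ 0` (`k` or `l` odd),
for all `(k, l)` with `k, l ≤ 4` or with `min(k,l) = 0` and `max(k,l) ≤ 8`, then the sets
`{n : xₙ + yₙ < −2.47}` and `{n : xₙ + yₙ > 2.47}` have positive upper density. -/
theorem trace_asymptotics_BC2_a1
    (x y : ℕ → ℝ)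
    (hx : ∀ n, x n ∈ Set.Icc (-2 : ℝ) 2) (hy : ∀ n, y n ∈ Set.Icc (-2 : ℝ) 2)
    (hmom : ∀ k l : ℕ, ((k ≤ 4 ∧ l ≤ 4) ∨ (min k l = 0 ∧ max k l ≤ 8)) →
      Tendsto (fun N => (∑ n ∈ Finset.range N, x n ^ k * y n ^ l) / N) atTop
        (nhds (if k % 2 = 0 ∧ l % 2 = 0 then (catalan (k / 2) : ℝ) * catalan (l / 2) else 0))) :
    0 < upperDensity {n | x n + y n < -2.47} ∧
    0 < upperDensity {n | x n + y n > 2.47} := by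
  constructor
  · have h := upper (fun n => - x n) (fun n => - y n)
      (fun n => ⟨by linarith [(hx n).2], by linarith [(hx n).1]⟩)
      (fun n => ⟨by linarith [(hy n).2], by linarith [(hy n).1]⟩) (fun k l hkl => by
        have h0 := (hmom k l hkl).const_mul ((-1 : ℝ) ^ (k + l))
        have hv : (-1 : ℝ) ^ (k + l) * (if k % 2 = 0 ∧ l % 2 = 0 then
            (catalan (k / 2) : ℝ) * catalan (l / 2) else 0) = mm k l := by
          unfold mm
          split_ifs with hc
          · have : Even (k + l) := by rw [Nat.even_iff]; omega
            rw [this.neg_one_pow, one_mul]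
          · simp
        rw [hv] at h0
        refine h0.congr fun N => ?_
        rw [← mul_div_assoc, Finset.mul_sum]
        congr 1
        refine Finset.sum_congr rfl fun n _ => ?_
        simp only [neg_pow (x n), neg_pow (y n)]
        ring)
    have hs : {n | - x n + - y n > 2.47} = {n | x n + y n < -2.47} := by
      ext n
      simp only [Set.mem_ofPred_eq]
      constructor <;> intro h <;> linarith
    rw [← hs]
    exact h
  · exact upper x y hx hy hmom
end

section
/- Define the polynomial Q(x, y) = −12.543(x+y) + 53.838(x²+y²) − 12.954(x³+y³) − 13.063(x⁴+y⁴) − 7.914(x⁵+y⁵) − 2.9(x⁶+y⁶) + 3.607(x⁷+y⁷) + 1.575(x⁸+y⁸) + 124.68·xy − 183.789(x²y + xy²) + 1.878(x³y + xy³) + 50.255(x⁴y + xy⁴) + 117.628·x²y² + 73.149(x³y² + x²y³) − 48.646(x⁴y² + x²y⁴) − 65.928·x³y³ + 8.734(x⁴y³ + x³y⁴) + 1.098·x⁴y⁴ (all decimal coefficients exact). Then: (a) for all real x, y with x, y ∈ [−2, 2] and x + y ≥ −2.47, one has Q(x, y) > −2.04; and (b) replacing each monomial xᵏyˡ in Q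 by mₖ·mₗ, where mₖ = C_{k/2} if k is even and mₖ = 0 if k is odd, the resulting sum equals exactly −2.04. -/
/-- The polynomial `Q` of Theorem 4.3, written as a linear combination of monomial values
`f k l` (standing for `xᵏyˡ`). -/
noncomputable def Qcomb (f : ℕ → ℕ → ℝ) : ℝ :=
  -12.543 * (f 1 0 + f 0 1) + 53.838 * (f 2 0 + f 0 2) - 12.954 * (f 3 0 + f 0 3)
    - 13.063 * (f 4 0 + f 0 4) - 7.914 * (f 5 0 + f 0 5) - 2.9 * (f 6 0 + f 0 6)
    + 3.607 * (f 7 0 + f 0 7) + 1.575 * (f 8 0 + f 0 8)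
    + 124.68 * f 1 1 - 183.789 * (f 2 1 + f 1 2) + 1.878 * (f 3 1 + f 1 3)
    + 50.255 * (f 4 1 + f 1 4) + 117.628 * f 2 2 + 73.149 * (f 3 2 + f 2 3)
    - 48.646 * (f 4 2 + f 2 4) - 65.928 * f 3 3 + 8.734 * (f 4 3 + f 3 4)
    + 1.098 * f 4 4

/-- The polynomial `Q(x, y)` of Theorem 4.3. -/
noncomputable def Q (x y : ℝ) : ℝ := Qcomb (fun k l => x ^ k * y ^ l)

/-- The "Catalan moment" `mₖ = C_{k/2}` for even `k`, `0` for odd `k`. -/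
noncomputable def catalanMoment (k : ℕ) : ℝ :=
  if k % 2 = 0 then (catalan (k / 2) : ℝ) else 0


structure P8 where
  (x008 x017 x026 x035 x044 x053 x062 x071 x080 x107 x116 x125 x134 x143 x152 x161 x170 x206
  x215 x224 x233 x242 x251 x260 x305 x314 x323 x332 x341 x350 x404 x413 x422 x431 x440 x503
  x512 x521 x530 x602 x611 x620 x701 x710 x800 : ℤ)

namespace P8

def ev (p : P8) (a b c : ℝ) : ℝ :=
  p.x008 * c ^ 8 + p.x017 * b ^ 1 * c ^ 7 + p.x026 * b ^ 2 * c ^ 6 + p.x035 * b ^ 3 * c ^ 5 +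
  p.x044 * b ^ 4 * c ^ 4 + p.x053 * b ^ 5 * c ^ 3 + p.x062 * b ^ 6 * c ^ 2 +
  p.x071 * b ^ 7 * c ^ 1 + p.x080 * b ^ 8 + p.x107 * a ^ 1 * c ^ 7 +
  p.x116 * a ^ 1 * b ^ 1 * c ^ 6 + p.x125 * a ^ 1 * b ^ 2 * c ^ 5 +
  p.x134 * a ^ 1 * b ^ 3 * c ^ 4 + p.x143 * a ^ 1 * b ^ 4 * c ^ 3 +
  p.x152 * a ^ 1 * b ^ 5 * c ^ 2 + p.x161 * a ^ 1 * b ^ 6 * c ^ 1 + p.x170 * a ^ 1 * b ^ 7 +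
  p.x206 * a ^ 2 * c ^ 6 + p.x215 * a ^ 2 * b ^ 1 * c ^ 5 + p.x224 * a ^ 2 * b ^ 2 * c ^ 4 +
  p.x233 * a ^ 2 * b ^ 3 * c ^ 3 + p.x242 * a ^ 2 * b ^ 4 * c ^ 2 +
  p.x251 * a ^ 2 * b ^ 5 * c ^ 1 + p.x260 * a ^ 2 * b ^ 6 + p.x305 * a ^ 3 * c ^ 5 +
  p.x314 * a ^ 3 * b ^ 1 * c ^ 4 + p.x323 * a ^ 3 * b ^ 2 * c ^ 3 +
  p.x332 * a ^ 3 * b ^ 3 * c ^ 2 + p.x341 * a ^ 3 * b ^ 4 * c ^ 1 + p.x350 * a ^ 3 * b ^ 5 +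
  p.x404 * a ^ 4 * c ^ 4 + p.x413 * a ^ 4 * b ^ 1 * c ^ 3 + p.x422 * a ^ 4 * b ^ 2 * c ^ 2 +
  p.x431 * a ^ 4 * b ^ 3 * c ^ 1 + p.x440 * a ^ 4 * b ^ 4 + p.x503 * a ^ 5 * c ^ 3 +
  p.x512 * a ^ 5 * b ^ 1 * c ^ 2 + p.x521 * a ^ 5 * b ^ 2 * c ^ 1 + p.x530 * a ^ 5 * b ^ 3 +
  p.x602 * a ^ 6 * c ^ 2 + p.x611 * a ^ 6 * b ^ 1 * c ^ 1 + p.x620 * a ^ 6 * b ^ 2 +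
  p.x701 * a ^ 7 * c ^ 1 + p.x710 * a ^ 7 * b ^ 1 + p.x800 * a ^ 8

def sub (p : P8) : P8 :=
  ⟨p.x008, p.x017, p.x026, p.x035, p.x044, p.x053, p.x062, p.x071, p.x080, p.x107 + p.x017,
  p.x116 + 2 * p.x026, p.x125 + 3 * p.x035, p.x134 + 4 * p.x044, p.x143 + 5 * p.x053,
  p.x152 + 6 * p.x062, p.x161 + 7 * p.x071, p.x170 + 8 * p.x080, p.x206 + p.x116 + p.x026,
  p.x215 + 2 * p.x125 + 3 * p.x035, p.x224 + 3 * p.x134 + 6 * p.x044,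
  p.x233 + 4 * p.x143 + 10 * p.x053, p.x242 + 5 * p.x152 + 15 * p.x062,
  p.x251 + 6 * p.x161 + 21 * p.x071, p.x260 + 7 * p.x170 + 28 * p.x080,
  p.x305 + p.x215 + p.x125 + p.x035, p.x314 + 2 * p.x224 + 3 * p.x134 + 4 * p.x044,
  p.x323 + 3 * p.x233 + 6 * p.x143 + 10 * p.x053,
  p.x332 + 4 * p.x242 + 10 * p.x152 + 20 * p.x062,
  p.x341 + 5 * p.x251 + 15 * p.x161 + 35 * p.x071,
  p.x350 + 6 * p.x260 + 21 * p.x170 + 56 * p.x080, p.x404 + p.x314 + p.x224 + p.x134 + p.x044,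
  p.x413 + 2 * p.x323 + 3 * p.x233 + 4 * p.x143 + 5 * p.x053,
  p.x422 + 3 * p.x332 + 6 * p.x242 + 10 * p.x152 + 15 * p.x062,
  p.x431 + 4 * p.x341 + 10 * p.x251 + 20 * p.x161 + 35 * p.x071,
  p.x440 + 5 * p.x350 + 15 * p.x260 + 35 * p.x170 + 70 * p.x080,
  p.x503 + p.x413 + p.x323 + p.x233 + p.x143 + p.x053,
  p.x512 + 2 * p.x422 + 3 * p.x332 + 4 * p.x242 + 5 * p.x152 + 6 * p.x062,
  p.x521 + 3 * p.x431 + 6 * p.x341 + 10 * p.x251 + 15 * p.x161 + 21 * p.x071,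
  p.x530 + 4 * p.x440 + 10 * p.x350 + 20 * p.x260 + 35 * p.x170 + 56 * p.x080,
  p.x602 + p.x512 + p.x422 + p.x332 + p.x242 + p.x152 + p.x062,
  p.x611 + 2 * p.x521 + 3 * p.x431 + 4 * p.x341 + 5 * p.x251 + 6 * p.x161 + 7 * p.x071,
  p.x620 + 3 * p.x530 + 6 * p.x440 + 10 * p.x350 + 15 * p.x260 + 21 * p.x170 + 28 * p.x080,
  p.x701 + p.x611 + p.x521 + p.x431 + p.x341 + p.x251 + p.x161 + p.x071,
  p.x710 + 2 * p.x620 + 3 * p.x530 + 4 * p.x440 + 5 * p.x350 + 6 * p.x260 + 7 * p.x170 + 8 * p.x080,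
  p.x800 + p.x710 + p.x620 + p.x530 + p.x440 + p.x350 + p.x260 + p.x170 + p.x080⟩

def sw (p : P8) : P8 :=
  ⟨p.x008, p.x107, p.x206, p.x305, p.x404, p.x503, p.x602, p.x701, p.x800, p.x017, p.x116,
  p.x215, p.x314, p.x413, p.x512, p.x611, p.x710, p.x026, p.x125, p.x224, p.x323, p.x422,
  p.x521, p.x620, p.x035, p.x134, p.x233, p.x332, p.x431, p.x530, p.x044, p.x143, p.x242,
  p.x341, p.x440, p.x053, p.x152, p.x251, p.x350, p.x062, p.x161, p.x260, p.x071, p.x170,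
  p.x080⟩

def rot (p : P8) : P8 :=
  ⟨p.x800, p.x701, p.x602, p.x503, p.x404, p.x305, p.x206, p.x107, p.x008, p.x710, p.x611,
  p.x512, p.x413, p.x314, p.x215, p.x116, p.x017, p.x620, p.x521, p.x422, p.x323, p.x224,
  p.x125, p.x026, p.x530, p.x431, p.x332, p.x233, p.x134, p.x035, p.x440, p.x341, p.x242,
  p.x143, p.x044, p.x350, p.x251, p.x152, p.x053, p.x260, p.x161, p.x062, p.x170, p.x071,
  p.x080⟩

def nn : ℤ → Bool
  | .ofNat _ => true
  | .negSucc _ => false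

theorem nn_le {z : ℤ} (h : nn z = true) : (0 : ℝ) ≤ z := by
  cases z with
  | ofNat n => simp
  | negSucc n => simp [nn] at h

def pos (p : P8) : Bool :=
  nn p.x008 && nn p.x017 && nn p.x026 && nn p.x035 && nn p.x044 && nn p.x053 && nn p.x062 &&
  nn p.x071 && nn p.x080 && nn p.x107 && nn p.x116 && nn p.x125 && nn p.x134 && nn p.x143 &&
  nn p.x152 && nn p.x161 && nn p.x170 && nn p.x206 && nn p.x215 && nn p.x224 && nn p.x233 &&
  nn p.x242 && nn p.x251 && nn p.x260 && nn p.x305 && nn p.x314 && nn p.x323 && nn p.x332 &&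
  nn p.x341 && nn p.x350 && nn p.x404 && nn p.x413 && nn p.x422 && nn p.x431 && nn p.x440 &&
  nn p.x503 && nn p.x512 && nn p.x521 && nn p.x530 && nn p.x602 && nn p.x611 && nn p.x620 &&
  nn p.x701 && nn p.x710 && nn p.x800

theorem ev_sub (p : P8) (a b c : ℝ) : p.sub.ev a b c = p.ev a (a + b) c := by
  simp only [ev, sub]
  push_cast
  ring

theorem ev_sw (p : P8) (a b c : ℝ) : p.sw.ev b a c = p.ev a b c := by
  simp only [ev, sw]
  ring

theorem ev_rot (p : P8) (a b c : ℝ) : p.rot.ev b c a = p.ev a b c := by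
  simp only [ev, rot]
  ring

theorem ev_pos (p : P8) (a b c : ℝ) (ha : 0 ≤ a) (hb : 0 ≤ b) (hc : 0 ≤ c)
    (h : p.pos = true) : 0 ≤ p.ev a b c := by
  simp only [pos, Bool.and_eq_true, and_assoc] at h
  obtain ⟨h008, h017, h026, h035, h044, h053, h062, h071, h080, h107, h116, h125, h134, h143, h152, h161, h170, h206, h215, h224, h233, h242, h251, h260, h305, h314, h323, h332, h341, h350, h404, h413, h422, h431, h440, h503, h512, h521, h530, h602, h611, h620, h701, h710, h800⟩ := h
  replace h008 := nn_le h008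
  replace h017 := nn_le h017
  replace h026 := nn_le h026
  replace h035 := nn_le h035
  replace h044 := nn_le h044
  replace h053 := nn_le h053
  replace h062 := nn_le h062
  replace h071 := nn_le h071
  replace h080 := nn_le h080
  replace h107 := nn_le h107
  replace h116 := nn_le h116
  replace h125 := nn_le h125
  replace h134 := nn_le h134
  replace h143 := nn_le h143
  replace h152 := nn_le h152
  replace h161 := nn_le h161
  replace h170 := nn_le h170
  replace h206 := nn_le h206
  replace h215 := nn_le h215
  replace h224 := nn_le h224
  replace h233 := nn_le h233
  replace h242 := nn_le h242
  replace h251 := nn_le h251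
  replace h260 := nn_le h260
  replace h305 := nn_le h305
  replace h314 := nn_le h314
  replace h323 := nn_le h323
  replace h332 := nn_le h332
  replace h341 := nn_le h341
  replace h350 := nn_le h350
  replace h404 := nn_le h404
  replace h413 := nn_le h413
  replace h422 := nn_le h422
  replace h431 := nn_le h431
  replace h440 := nn_le h440
  replace h503 := nn_le h503
  replace h512 := nn_le h512
  replace h521 := nn_le h521
  replace h530 := nn_le h530
  replace h602 := nn_le h602
  replace h611 := nn_le h611
  replace h620 := nn_le h620
  replace h701 := nn_le h701
  replace h710 := nn_le h710
  replace h800 := nn_le h800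
  unfold ev
  positivity

inductive Tr
  | l : Tr
  | s : Tr → Tr → Tr
  | r : Tr → Tr

def chk : Tr → P8 → Bool
  | .l, p => p.pos
  | .s t u, p => chk t p.sub && chk u p.sw.sub
  | .r t, p => chk t p.rot

theorem chk_sound (t : Tr) : ∀ (p : P8), chk t p = true → ∀ a b c : ℝ, 0 ≤ a → 0 ≤ b → 0 ≤ c →
    0 ≤ p.ev a b c := by
  induction t with
  | l => intro p h a b c ha hb hc; exact ev_pos p a b c ha hb hc h
  | s t u iht ihu =>
    intro p h a b c ha hb hc
    simp only [chk, Bool.and_eq_true] at h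
    rcases le_total a b with hab | hab
    · have := iht _ h.1 a (b - a) c ha (by linarith) hc
      rw [ev_sub] at this
      simpa using this
    · have := ihu _ h.2 b (a - b) c hb (by linarith) hc
      rw [ev_sub, add_sub_cancel, ev_sw] at this
      exact this
  | r t ih =>
    intro p h a b c ha hb hc
    have := ih _ h b c a hb hc ha
    rwa [ev_rot] at this

def P0 : P8 :=
  ⟨36162086913821750878383200, -189351952686845576581891200, 412297336225747539053440000,
  -464815757806692093376000000, 292573736200250761600000000, -118751742973102720000000000,
  33156358023296000000000000, -487543152000000000000000, 25083520000000000000000,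
  42810639956705547942587200, -254182877805775619223179200, 581146373936079160056320000,
  -525029315878817492720000000, 264585990262473884800000000, -140271196286176480000000000,
  6973276140288000000000000, -487543152000000000000000, 27532230782740584236932800,
  -136645349426527368112208800, 306106863974885354689600000, -88878113530133281112000000,
  183916260377565916800000000, -32279179969610640000000000, 3486638070144000000000000,
  5996875010282836080884400, -86771261383277806825307600, -48020219960065345561920000,
  -27222331879953063864000000, 51623265246328974400000000, -10759726656536880000000000,
  1345471815542185766329456, 11856609495964176801879000, -91447426198655236669680000,
  1802779472568522380000000, 12905816311582243600000000, -79931234373341684462388,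
  45145040075983525253183300, -47665422725183340167520000, 360555894513704476000000,
  -3057765859080057516566, 21386859088395344946403750, -7944237120863890027920000,
  4398902801347238525928, 3055265584056477849486250, 549862850168404815741⟩

def T0 : Tr :=
  .r (.s (.r (.s (.r (.s (.r (.s (.r (.s .l .l)) (.r (.s .l (.r (.s .l (.r (.s .l (.r (.s .l
  (.r (.s .l (.r (.s .l (.r (.s .l (.r (.s .l (.r (.s .l (.r (.s .l (.r (.s .l (.r (.s .l (.r
  (.s .l (.r (.s .l .l)))))))))))))))))))))))))))))) (.r (.s (.r (.s (.r (.s (.r (.s (.r (.s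
  .l (.r (.s .l (.r (.s .l .l)))))) .l)) (.r (.s (.r (.s (.r (.s (.r (.s .l .l)) .l)) (.r (.s
  (.r (.s (.r (.s .l .l)) .l)) (.r (.s (.r (.s (.r (.s .l .l)) .l)) (.r (.s (.r (.s (.r (.s .l
  (.r (.s .l (.r (.s .l .l)))))) .l)) (.r (.s (.r (.s (.r (.s .l .l)) (.r (.s .l (.r (.s .l
  .l)))))) (.r (.s (.r (.s (.r (.s .l .l)) .l)) (.r (.s (.r (.s .l .l)) .l)))))))))))))) (.r
  (.s (.r (.s .l .l)) .l)))))) (.r (.s (.r (.s (.r (.s .l .l)) .l)) (.r (.s (.r (.s .l .l))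
  .l)))))) (.r (.s (.r (.s .l (.r (.s .l (.r (.s .l .l)))))) .l)))))) (.r (.s (.r (.s .l (.r
  (.s .l (.r (.s .l (.r (.s .l (.r (.s .l (.r (.s .l (.r (.s .l (.r (.s .l (.r (.s .l (.r (.s
  .l (.r (.s .l (.r (.s .l (.r (.s .l (.r (.s .l (.r (.s .l .l))))))))))))))))))))))))))))))
  .l)))) (.r (.s (.r (.s (.r (.s .l (.r (.s .l (.r (.s .l (.r (.s .l (.r (.s .l (.r (.s .l (.r
  (.s .l (.r (.s .l (.r (.s .l (.r (.s .l .l)))))))))))))))))))) (.r (.s (.r (.s (.r (.s (.r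
  (.s .l .l)) .l)) (.r (.s (.r (.s .l .l)) .l)))) (.r (.s (.r (.s .l .l)) .l)))))) (.r (.s (.r
  (.s (.r (.s (.r (.s .l .l)) .l)) (.r (.s (.r (.s (.r (.s .l .l)) .l)) (.r (.s (.r (.s (.r
  (.s .l .l)) .l)) (.r (.s (.r (.s (.r (.s .l .l)) .l)) (.r (.s (.r (.s (.r (.s .l .l)) .l))
  (.r (.s (.r (.s (.r (.s .l .l)) .l)) (.r (.s (.r (.s (.r (.s .l .l)) .l)) (.r (.s (.r (.s .l
  .l)) .l)))))))))))))))) (.r (.s (.r (.s .l .l)) (.r (.s .l (.r (.s .l (.r (.s .l (.r (.s .l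
  (.r (.s .l (.r (.s .l .l)))))))))))))))))))

theorem chk0 : chk T0 P0 = true := by decide +kernel

theorem ev0 (x y : ℝ) :
    P0.ev (2 * (2 - x)) (x + y + 2.47) (x - y) = (982616887302702502533152000 / 1 : ℝ) * (Q x y + 2.03) := by
  simp only [ev, P0, Q, Qcomb]
  push_cast
  ring

theorem main_aux (x y : ℝ) (hx : x ≤ 2) (hxy : y ≤ x) (h : x + y ≥ -2.47) : Q x y > -2.04 := by
  have h0 := chk_sound T0 P0 chk0 (2 * (2 - x)) (x + y + 2.47) (x - y)
    (by linarith) (by linarith) (by linarith)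
  rw [ev0] at h0
  have : 0 ≤ Q x y + 2.03 := by
    by_contra hn
    push Not at hn
    linarith
  norm_num at this ⊢
  linarith

end P8

theorem Q_symm (x y : ℝ) : Q x y = Q y x := by
  simp only [Q, Qcomb]
  ring

/-- (a) On `{(x,y) ∈ [−2,2]² : x + y ≥ −2.47}` one has `Q(x,y) > −2.04`;
(b) replacing each monomial `xᵏyˡ` of `Q` by `mₖ·mₗ` gives exactly `−2.04`. -/
theorem Q_min_and_moment :
    (∀ x y : ℝ, x ∈ Set.Icc (-2 : ℝ) 2 → y ∈ Set.Icc (-2 : ℝ) 2 → x + y ≥ -2.47 →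
      Q x y > -2.04) ∧
    Qcomb (fun k l => catalanMoment k * catalanMoment l) = -2.04 := by
  constructor
  · intro x y hx hy h
    rcases le_total y x with hxy | hxy
    · exact P8.main_aux x y hx.2 hxy h
    · rw [Q_symm]
      exact P8.main_aux y x hy.2 hxy (by linarith)
  · have c3 : catalan 3 = 5 := catalan_three
    have c4 : catalan 4 = 14 := by
      rw [catalan_eq_centralBinom_div]; decide
    simp only [Qcomb, catalanMoment]
    norm_num [catalan_zero, catalan_one, catalan_two, c3, c4]
end

section
/- Define the polynomial R(x, y) = −24.04(x²+y²) + 39.64(x⁴+y⁴) − 13.14(x⁶+y⁶) + 3.82(x⁸+y⁸) − 15.76·xy − 119.88(x³y + xy³) + 484.32·x²y² − 153.28(x⁴y² + x²y⁴) + 192.44·x³y³ + 8.2·x⁴y⁴ (all decimal coefficients exact). Then: (a) for all real x, y with x, y ∈ [−2, 2] and x·y ≥ −1.57, one has R(x, y) > −9.96; and (b) replacing each monomial xᵏyˡ in R by mₖ·mₗ, where mₖ = C_{k/2} if k is even and mₖ = 0 if k is odd, the resulting sum equals exactly −9.96. -/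
/-- The polynomial `R` of Theorem 4.4, written as a linear combination of monomial values
`f k l` (standing for `xᵏyˡ`). -/
noncomputable def Rcomb (f : ℕ → ℕ → ℝ) : ℝ :=
  -24.04 * (f 2 0 + f 0 2) + 39.64 * (f 4 0 + f 0 4) - 13.14 * (f 6 0 + f 0 6)
    + 3.82 * (f 8 0 + f 0 8) - 15.76 * f 1 1 - 119.88 * (f 3 1 + f 1 3)
    + 484.32 * f 2 2 - 153.28 * (f 4 2 + f 2 4) + 192.44 * f 3 3 + 8.2 * f 4 4

/-- The polynomial `R(x, y)` of Theorem 4.4. -/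
noncomputable def R (x y : ℝ) : ℝ := Rcomb (fun k l => x ^ k * y ^ l)

theorem quart (A B C q s : ℝ) (hA : 0 < A) (hD : 0 < 4*A*C - B^2) :
    0 < 3.82*(s^2 - (657/382)*s + q)^2 + A*s^2 + B*s + C := by
  have h : 0 < 4*A*(A*s^2 + B*s + C) := by nlinarith [sq_nonneg (2*A*s+B)]
  have h' : 0 < A*s^2 + B*s + C := by
    by_contra hc
    nlinarith
  have := sq_nonneg (s^2 - (657/382)*s + q)
  linarith

theorem A1_pos (p : ℝ) (h1 : (-157/100) ≤ p) (h2 : p ≤ (0)) :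
    0 < (26919051/955000)*p^0 + (5539/250)*p^1 + (8213/625)*p^2 := by
  have u : 0 ≤ p - (-157/100) := by linarith
  have v : 0 ≤ (0) - p := by linarith
  have e : (26919051/955000)*p^0 + (5539/250)*p^1 + (8213/625)*p^2 = (539/100) + ((24356470267/2942474375)*((p-(-157/100))^0*((0)-p)^2)
    + (103236034/23539795)*((p-(-157/100))^1*((0)-p)^1)
    + (43543202/4707959)*((p-(-157/100))^2*((0)-p)^0)) := by ring
  rw [e]
  positivity

theorem D1_pos (p : ℝ) (h1 : (-157/100) ≤ p) (h2 : p ≤ (0)) :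
    0 < (4159189129321/7460937500)*p^0 + (-12470729171377/1492187500)*p^1 + (31998060454191/3730468750)*p^2 + (-2507784769189/373046875)*p^3 + (-9528137490727/7460937500)*p^4 + (4886499497/1953125)*p^5 + (-19004208534/9765625)*p^6 := by
  have u : 0 ≤ p - (-157/100) := by linarith
  have v : 0 ≤ (0) - p := by linarith
  have e : (4159189129321/7460937500)*p^0 + (-12470729171377/1492187500)*p^1 + (31998060454191/3730468750)*p^2 + (-2507784769189/373046875)*p^3 + (-9528137490727/7460937500)*p^4 + (4886499497/1953125)*p^5 + (-19004208534/9765625)*p^6 = (3399/100) + ((63407585152381312831694/27933883982487880859375)*((p-(-157/100))^0*((0)-p)^6)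
    + (2864678702986658025069564/223471071859903046875)*((p-(-157/100))^1*((0)-p)^5)
    + (1003360584780134298139492/44694214371980609375)*((p-(-157/100))^2*((0)-p)^4)
    + (6022839697315584648768/357553714975844875)*((p-(-157/100))^3*((0)-p)^3)
    + (451714583269797146752/71510742995168975)*((p-(-157/100))^4*((0)-p)^2)
    + (3106016644543627520/2860429719806759)*((p-(-157/100))^5*((0)-p)^1)
    + (99983151710617600/2860429719806759)*((p-(-157/100))^6*((0)-p)^0)) := by ring
  rw [e]
  positivity

theorem piece1 (s p : ℝ) (h1 : (-157/100) ≤ p) (h2 : p ≤ (0)) :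
    0 < 3.82*s^4-13.14*s^3+s^2*(39.64-15.28*p^2)+s*(-24.04-119.88*p-113.86*p^2)+405.04*p^2-15.76*p+192.44*p^3+15.84*p^4+9.96 := by
  have hA := A1_pos p h1 h2
  have hD := D1_pos p h1 h2
  have := quart ((26919051/955000)*p^0 + (5539/250)*p^1 + (8213/625)*p^2) ((-59443/2500)*p^0 + (-78993/500)*p^1 + (-101713/625)*p^2) ((1244809/125000)*p^0 + (-191461/12500)*p^1 + (46685277/125000)*p^2 + (687623/6250)*p^3 + (-1156959/31250)*p^4) ((1/50)*p^0 + (-29/10)*p^1 + (-93/25)*p^2) s hA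
    (lt_of_lt_of_eq hD (by ring))
  refine lt_of_lt_of_eq this (by ring)

theorem A2_pos (p : ℝ) (h1 : (0) ≤ p) (h2 : p ≤ (1/2)) :
    0 < (23854647/955000)*p^0 + (-7449/250)*p^1 + (99511/1250)*p^2 := by
  have u : 0 ≤ p - (0) := by linarith
  have v : 0 ≤ (1/2) - p := by linarith
  have e : (23854647/955000)*p^0 + (-7449/250)*p^1 + (99511/1250)*p^2 = (219/25) + ((15488847/238750)*((p-(0))^0*((1/2)-p)^2)
    + (8375052/119375)*((p-(0))^1*((1/2)-p)^1)
    + (10133929/119375)*((p-(0))^2*((1/2)-p)^0)) := by ring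
  rw [e]
  positivity

theorem D2_pos (p : ℝ) (h1 : (0) ≤ p) (h2 : p ≤ (1/2)) :
    0 < (2193103792979/3730468750)*p^0 + (-4841989363281/746093750)*p^1 + (113349589138259/3730468750)*p^2 + (-27864678998509/746093750)*p^3 + (-576910837287499/7460937500)*p^4 + (1933314343757/7812500)*p^5 + (-7132692836241/39062500)*p^6 := by
  have u : 0 ≤ p - (0) := by linarith
  have v : 0 ≤ (1/2) - p := by linarith
  have e : (2193103792979/3730468750)*p^0 + (-4841989363281/746093750)*p^1 + (113349589138259/3730468750)*p^2 + (-27864678998509/746093750)*p^3 + (-576910837287499/7460937500)*p^4 + (1933314343757/7812500)*p^5 + (-7132692836241/39062500)*p^6 = (633/100) + ((69423677625328/1865234375)*((p-(0))^0*((1/2)-p)^6)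
    + (29182916689488/1865234375)*((p-(0))^1*((1/2)-p)^5)
    + (11356132173592/1865234375)*((p-(0))^2*((1/2)-p)^4)
    + (584775334335868/1865234375)*((p-(0))^3*((1/2)-p)^3)
    + (359752375193513/1865234375)*((p-(0))^4*((1/2)-p)^2)
    + (408776715044571/3730468750)*((p-(0))^5*((1/2)-p)^1)
    + (148913362498803/7460937500)*((p-(0))^6*((1/2)-p)^0)) := by ring
  rw [e]
  positivity

theorem piece2 (s p : ℝ) (h1 : (0) ≤ p) (h2 : p ≤ (1/2)) :
    0 < 3.82*s^4-13.14*s^3+s^2*(39.64-15.28*p^2)+s*(-24.04-119.88*p-113.86*p^2)+405.04*p^2-15.76*p+192.44*p^3+15.84*p^4+9.96 := by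
  have hA := A2_pos p h1 h2
  have hD := D2_pos p h1 h2
  have := quart ((23854647/955000)*p^0 + (-7449/250)*p^1 + (99511/1250)*p^2) ((-22823/1250)*p^0 + (-34317/500)*p^1 + (-692647/2500)*p^2) ((288139/31250)*p^0 + (-180439/6250)*p^1 + (48586109/125000)*p^2 + (7031329/12500)*p^3 + (-71677431/125000)*p^4) ((11/25)*p^0 + (39/10)*p^1 + (-621/50)*p^2) s hA
    (lt_of_lt_of_eq hD (by ring))
  refine lt_of_lt_of_eq this (by ring)

theorem A3_pos (p : ℝ) (h1 : (1/2) ≤ p) (h2 : p ≤ (12/5)) :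
    0 < (8897437/955000)*p^0 + (24639/625)*p^1 + (3247/2500)*p^2 := by
  have u : 0 ≤ p - (1/2) := by linarith
  have v : 0 ≤ (12/5) - p := by linarith
  have e : (8897437/955000)*p^0 + (24639/625)*p^1 + (3247/2500)*p^2 = (1467/100) + ((28043743/6895100)*((p-(1/2))^0*((12/5)-p)^2)
    + (254830901/8618875)*((p-(1/2))^1*((12/5)-p)^1)
    + (2309704171/86188750)*((p-(1/2))^2*((12/5)-p)^0)) := by ring
  rw [e]
  positivity

theorem D3_pos (p : ℝ) (h1 : (1/2) ≤ p) (h2 : p ≤ (12/5)) :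
    0 < (-35023505024221/59687500000)*p^0 + (62139092171873/14921875000)*p^1 + (-417115486879249/59687500000)*p^2 + (19813217993857/3730468750)*p^3 + (-101710267025083/59687500000)*p^4 + (16923094117/78125000)*p^5 + (-3487274753/312500000)*p^6 := by
  have u : 0 ≤ p - (1/2) := by linarith
  have v : 0 ≤ (12/5) - p := by linarith
  have e : (-35023505024221/59687500000)*p^0 + (62139092171873/14921875000)*p^1 + (-417115486879249/59687500000)*p^2 + (19813217993857/3730468750)*p^3 + (-101710267025083/59687500000)*p^4 + (16923094117/78125000)*p^5 + (-3487274753/312500000)*p^6 = (2893/25) + ((750844539827933/179715265420000)*((p-(1/2))^0*((12/5)-p)^6)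
    + (2253708378959817/56161020443750)*((p-(1/2))^1*((12/5)-p)^5)
    + (41442437345878293/1123220408875000)*((p-(1/2))^2*((12/5)-p)^4)
    + (127903059659882086/702012755546875)*((p-(1/2))^3*((12/5)-p)^3)
    + (2318159297204540923/7020127555468750)*((p-(1/2))^4*((12/5)-p)^2)
    + (3198393351141104656/17550318888671875)*((p-(1/2))^5*((12/5)-p)^1)
    + (1940719068668105846/87751594443359375)*((p-(1/2))^6*((12/5)-p)^0)) := by ring
  rw [e]
  positivity

theorem piece3 (s p : ℝ) (h1 : (1/2) ≤ p) (h2 : p ≤ (12/5)) :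
    0 < 3.82*s^4-13.14*s^3+s^2*(39.64-15.28*p^2)+s*(-24.04-119.88*p-113.86*p^2)+405.04*p^2-15.76*p+192.44*p^3+15.84*p^4+9.96 := by
  have hA := A3_pos p h1 h2
  have hD := D3_pos p h1 h2
  have := quart ((8897437/955000)*p^0 + (24639/625)*p^1 + (3247/2500)*p^2) ((43393/5000)*p^0 + (-234603/1250)*p^1 + (-711869/5000)*p^2) ((-6862191/500000)*p^0 + (5150111/62500)*p^1 + (17230571/50000)*p^2 + (6680837/62500)*p^3 + (-1073999/500000)*p^4) ((249/100)*p^0 + (-129/25)*p^1 + (-217/100)*p^2) s hA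
    (lt_of_lt_of_eq hD (by ring))
  refine lt_of_lt_of_eq this (by ring)

theorem c0_pos (p : ℝ) (h1 : (12/5) ≤ p) (h2 : p ≤ (4)) :
    0 < (685)*p^0 + (-12382/25)*p^1 + (-13481/100)*p^2 + (16247/100)*p^3 + (-11057/400)*p^4 + (0)*p^5 + (-657/3200)*p^6 + (0)*p^7 + (191/12800)*p^8 := by
  have u : 0 ≤ p - (12/5) := by linarith
  have v : 0 ≤ (4) - p := by linarith
  have e : (685)*p^0 + (-12382/25)*p^1 + (-13481/100)*p^2 + (16247/100)*p^3 + (-11057/400)*p^4 + (0)*p^5 + (-657/3200)*p^6 + (0)*p^7 + (191/12800)*p^8 = (137/50) + ((452057481/838860800)*((p-(12/5))^0*((4)-p)^8)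
    + (163267237/20971520)*((p-(12/5))^1*((4)-p)^7)
    + (359231055/8388608)*((p-(12/5))^2*((4)-p)^6)
    + (481296815/4194304)*((p-(12/5))^3*((4)-p)^5)
    + (2760147075/16777216)*((p-(12/5))^4*((4)-p)^4)
    + (531996375/4194304)*((p-(12/5))^5*((4)-p)^3)
    + (401089375/8388608)*((p-(12/5))^6*((4)-p)^2)
    + (26715625/4194304)*((p-(12/5))^7*((4)-p)^1)
    + (2140625/33554432)*((p-(12/5))^8*((4)-p)^0)) := by ring
  rw [e]
  positivity

theorem c1_pos (p : ℝ) (h1 : (12/5) ≤ p) (h2 : p ≤ (4)) :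
    0 < (-16007/25)*p^0 + (2997/25)*p^1 + (2794/25)*p^2 + (0)*p^3 + (-217/160)*p^4 + (0)*p^5 + (-191/800)*p^6 := by
  have u : 0 ≤ p - (12/5) := by linarith
  have v : 0 ≤ (4) - p := by linarith
  have e : (-16007/25)*p^0 + (2997/25)*p^1 + (2794/25)*p^2 + (0)*p^3 + (-217/160)*p^4 + (0)*p^5 + (-191/800)*p^6 = (10027/100) + ((156682257/26214400)*((p-(12/5))^0*((4)-p)^6)
    + (210826407/2621440)*((p-(12/5))^1*((4)-p)^5)
    + (319014775/1048576)*((p-(12/5))^2*((4)-p)^4)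
    + (134466925/262144)*((p-(12/5))^3*((4)-p)^3)
    + (439805975/1048576)*((p-(12/5))^4*((4)-p)^2)
    + (77882875/524288)*((p-(12/5))^5*((4)-p)^1)
    + (12625625/1048576)*((p-(12/5))^6*((4)-p)^0)) := by ring
  rw [e]
  positivity

theorem piece4 (s p : ℝ) (h1 : (12/5) ≤ p) (h2 : p ≤ 4) (h3 : 2*p ≤ s) (h4 : s ≤ 4 + p^2/4) :
    0 < 3.82*s^4-13.14*s^3+s^2*(39.64-15.28*p^2)+s*(-24.04-119.88*p-113.86*p^2)+405.04*p^2-15.76*p+192.44*p^3+15.84*p^4+9.96 := by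
  have h0 := c0_pos p h1 h2
  have hc := c1_pos p h1 h2
  obtain ⟨t, ht⟩ : ∃ t, t = 4 + p^2/4 - s := ⟨_, rfl⟩
  have t0 : 0 ≤ t := by linarith
  have t1 : t ≤ 0.64 := by nlinarith
  obtain ⟨H, hH⟩ : ∃ H, H = 4 + p^2/4 := ⟨_, rfl⟩
  have hHp : 2*p ≤ H := by linarith
  have H5 : 4.8 ≤ H := by linarith
  have hpp : 4*p^2 ≤ H^2 := by nlinarith
  have h5 : 0 ≤ 22.92*H^2-39.42*H+39.64-15.28*p^2 - (15.28*H-13.14)*t := by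
    nlinarith [mul_nonneg (by linarith : (0:ℝ) ≤ 15.28*H-13.14) (by linarith : 0 ≤ 0.64 - t)]
  have h6 := mul_nonneg h5 (sq_nonneg t)
  have h7 := mul_nonneg hc.le t0
  have h8 : 0 ≤ t^4 := by positivity
  obtain rfl : s = 4 + p^2/4 - t := by linarith
  subst hH
  have := add_pos_of_pos_of_nonneg h0 (add_nonneg (add_nonneg h6 h7) (mul_nonneg (by norm_num : (0:ℝ) ≤ 3.82) h8))
  refine lt_of_lt_of_eq this (by ring)

/-- (a) On `{(x,y) ∈ [−2,2]² : x·y ≥ −1.57}` one has `R(x,y) > −9.96`;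
(b) replacing each monomial `xᵏyˡ` of `R` by `mₖ·mₗ` gives exactly `−9.96`. -/
theorem R_min_and_moment :
    (∀ x y : ℝ, x ∈ Set.Icc (-2 : ℝ) 2 → y ∈ Set.Icc (-2 : ℝ) 2 → x * y ≥ -1.57 →
      R x y > -9.96) ∧
    Rcomb (fun k l => catalanMoment k * catalanMoment l) = -9.96 := by
  constructor
  · intro x y hx hy hxy
    obtain ⟨hx1, hx2⟩ := hx
    obtain ⟨hy1, hy2⟩ := hy
    have key : ∀ s p : ℝ, s = x^2+y^2 → p = x*y → 0 < 3.82*s^4-13.14*s^3+s^2*(39.64-15.28*p^2)+s*(-24.04-119.88*p-113.86*p^2)+405.04*p^2-15.76*p+192.44*p^3+15.84*p^4+9.96 := by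
      intro s p hs hp
      have a1 : 2*p ≤ s := by rw [hs, hp]; nlinarith [sq_nonneg (x-y)]
      have a2 : s ≤ 4 + p^2/4 := by
        have b1 : 0 ≤ 4 - x^2 := by nlinarith
        have b2 : 0 ≤ 4 - y^2 := by nlinarith
        rw [hs, hp]; nlinarith [mul_nonneg b1 b2]
      have a3 : p ≤ 4 := by rw [hp]; nlinarith [sq_nonneg (x-y)]
      have a4 : (-157/100) ≤ p := by rw [hp]; norm_num at hxy ⊢; linarith
      rcases le_total p 0 with h | h
      · exact piece1 s p a4 h
      rcases le_total p (1/2) with h' | h'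
      · exact piece2 s p h h'
      rcases le_total p (12/5) with h'' | h''
      · exact piece3 s p h' h''
      · exact piece4 s p h'' a3 a1 a2
    have k := key _ _ rfl rfl
    have : 0 < R x y + 9.96 := by
      refine lt_of_lt_of_eq k ?_
      unfold R Rcomb
      ring
    linarith
  · have c4 : catalan 4 = 14 := by rw [catalan_eq_centralBinom_div]; decide
    norm_num [Rcomb, catalanMoment, catalan_two, catalan_three, c4]
end
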